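/- arXiv:0711.2722 — 2 statements merged into one kernel-verified Lean document; each statement's English description precedes it below -/
import Mathlib

section
/- For every integer N ≥ 1, every integer j ≥ 0, and pairwise distinct real numbers λ_1, …, λ_N, the determinant of the 2N×2N matrix A equals h_j(λ_1, λ_1, λ_2, λ_2, …, λ_N, λ_N) · ∏_{1 ≤ i < k ≤ N} (λ_i − λ_k)^4, where A is defined as follows: for 1 ≤ r ≤ 2N−1 the (r, 2m−1) entry is λ_m^{r−1} and the (r, 2m) entry is (r−1)·λ_m^{r−2}, while the (2N, 2m−1) entry is λ_m^{2N+j−1} and the (2N, 2m) entry is (2N+j−1)·λ_m^{2N+j−2} (each even-indexed column is the derivative in λ_m of the preceding column). -/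
/-- The complete homogeneous symmetric polynomial `h_j` in `n` variables. -/
noncomputable def hpoly (n j : ℕ) (x : Fin n → ℝ) : ℝ :=
  ∑ d ∈ Finset.Nat.antidiagonalTuple n j, ∏ i, x i ^ d i

open Polynomial

section Newton

variable {R : Type*} [CommRing R]

/-- The Newton basis polynomial `∏_{i < k} (X - x_i)`. -/
noncomputable def newtonPoly (x : ℕ → R) (k : ℕ) : R[X] :=
  ∏ i ∈ Finset.range k, (X - C (x i))

/-- The coefficient of `newtonPoly x k` in the expansion of `X ^ e` in the Newton basis. -/
def newtonCoeff (x : ℕ → R) : ℕ → ℕ → R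
  | 0, 0 => 1
  | 0, _ + 1 => 0
  | e + 1, 0 => x 0 * newtonCoeff x e 0
  | e + 1, k + 1 => newtonCoeff x e k + x (k + 1) * newtonCoeff x e (k + 1)

theorem newtonCoeff_eq_zero (x : ℕ → R) {e k : ℕ} (h : e < k) : newtonCoeff x e k = 0 := by
  induction e generalizing k with
  | zero =>
    obtain ⟨k, rfl⟩ := Nat.exists_eq_succ_of_ne_zero h.ne'
    simp [newtonCoeff]
  | succ e ih =>
    obtain ⟨k, rfl⟩ := Nat.exists_eq_succ_of_ne_zero (Nat.ne_zero_of_lt h)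
    simp only [newtonCoeff]
    rw [ih (by omega), ih (by omega)]
    simp

theorem newtonCoeff_self (x : ℕ → R) (e : ℕ) : newtonCoeff x e e = 1 := by
  induction e with
  | zero => simp [newtonCoeff]
  | succ e ih => simp [newtonCoeff, ih, newtonCoeff_eq_zero x (Nat.lt_succ_self e)]

theorem X_pow_eq_sum_newtonPoly (x : ℕ → R) (e : ℕ) {n : ℕ} (hn : e < n) :
    (X ^ e : R[X]) = ∑ k ∈ Finset.range n, C (newtonCoeff x e k) * newtonPoly x k := by
  induction e generalizing n with
  | zero =>
    obtain ⟨n, rfl⟩ := Nat.exists_eq_succ_of_ne_zero hn.ne'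
    simp [Finset.sum_range_succ', newtonCoeff, newtonPoly]
  | succ e ih =>
    obtain ⟨n, rfl⟩ := Nat.exists_eq_succ_of_ne_zero (Nat.ne_zero_of_lt hn)
    have hX (k : ℕ) : X * newtonPoly x k = newtonPoly x (k + 1) + C (x k) * newtonPoly x k := by
      simp only [newtonPoly, Finset.prod_range_succ]
      ring
    have h₁ := ih (n := n) (by omega)
    have h₂ := ih (n := n + 1) (by omega)
    calc (X ^ (e + 1) : R[X])
        = ∑ k ∈ Finset.range n, C (newtonCoeff x e k) * newtonPoly x (k + 1)
          + ∑ k ∈ Finset.range (n + 1), C (x k * newtonCoeff x e k) * newtonPoly x k := by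
          have h₃ : (∑ k ∈ Finset.range (n + 1), C (x k * newtonCoeff x e k) * newtonPoly x k) =
              ∑ k ∈ Finset.range n, C (x k * newtonCoeff x e k) * newtonPoly x k := by
            rw [Finset.sum_range_succ, newtonCoeff_eq_zero x (show e < n by omega)]
            simp
          rw [h₃, ← Finset.sum_add_distrib, pow_succ', h₁, Finset.mul_sum]
          refine Finset.sum_congr rfl fun k _ => ?_
          rw [mul_left_comm, hX, C_mul]
          ring
      _ = _ := by
          rw [Finset.sum_range_succ' _ n, Finset.sum_range_succ' _ n, ← add_assoc,
            ← Finset.sum_add_distrib]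
          congr 1
          refine Finset.sum_congr rfl fun k _ => ?_
          simp only [newtonCoeff, C_add]
          ring

theorem newtonPoly_dvd (x : ℕ → R) {k m : ℕ} (h : k ≤ m) : newtonPoly x k ∣ newtonPoly x m :=
  Finset.prod_dvd_prod_of_subset _ _ _ (Finset.range_mono h)

theorem prod_range_two_mul_div_two {M : Type*} [CommMonoid M] (f : ℕ → M) (n : ℕ) :
    ∏ i ∈ Finset.range (2 * n), f (i / 2) = ∏ i ∈ Finset.range n, f i ^ 2 := by
  induction n with
  | zero => simp
  | succ n ih =>
    rw [show 2 * (n + 1) = 2 * n + 1 + 1 by ring, Finset.prod_range_succ, Finset.prod_range_succ,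
      Finset.prod_range_succ, ih, show (2 * n + 1) / 2 = n by omega, show 2 * n / 2 = n by omega,
      mul_assoc, sq]

/-- Evaluation at the double node `l (c / 2)`, of the polynomial itself for even `c` and of its
derivative for odd `c`. -/
noncomputable def hermiteEval (l : ℕ → R) (c : ℕ) : R[X] →ₗ[R] R :=
  if c % 2 = 0 then leval (l (c / 2)) else leval (l (c / 2)) ∘ₗ derivative

theorem hermiteEval_X_pow (l : ℕ → R) (c e : ℕ) :
    hermiteEval l c (X ^ e) =
      if c % 2 = 0 then l (c / 2) ^ e else (e : R) * l (c / 2) ^ (e - 1) := by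
  unfold hermiteEval
  split_ifs <;> simp [leval_apply, derivative_X_pow]

theorem newtonPoly_doubled_two_mul_add_two (l : ℕ → R) (m : ℕ) :
    newtonPoly (fun i => l (i / 2)) (2 * m + 2) =
      newtonPoly (fun i => l (i / 2)) (2 * m) * (X - C (l m)) ^ 2 := by
  simp only [newtonPoly]
  rw [Finset.prod_range_succ, Finset.prod_range_succ, show (2 * m + 1) / 2 = m by omega,
    show 2 * m / 2 = m by omega, mul_assoc, sq]

theorem hermiteEval_newtonPoly_eq_zero (l : ℕ → R) {c k : ℕ} (h : c < k) :
    hermiteEval l c (newtonPoly (fun i => l (i / 2)) k) = 0 := by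
  rcases Nat.even_or_odd' c with ⟨m, rfl | rfl⟩
  · obtain ⟨q, hq⟩ := newtonPoly_dvd (fun i => l (i / 2)) (Nat.succ_le_of_lt h)
    rw [hq, newtonPoly, Finset.prod_range_succ]
    simp [hermiteEval, leval_apply]
  · obtain ⟨q, hq⟩ := newtonPoly_dvd (fun i => l (i / 2)) (show 2 * m + 2 ≤ k by omega)
    rw [hq, newtonPoly_doubled_two_mul_add_two]
    simp [hermiteEval, leval_apply, show (2 * m + 1) / 2 = m by omega, derivative_mul,
      derivative_pow]

theorem eval_newtonPoly_doubled (l : ℕ → R) (m : ℕ) :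
    (newtonPoly (fun i => l (i / 2)) (2 * m)).eval (l m) =
      ∏ i ∈ Finset.range m, (l m - l i) ^ 2 := by
  simp only [newtonPoly, eval_prod, eval_sub, eval_X, eval_C]
  exact prod_range_two_mul_div_two (fun i => l m - l i) m

theorem hermiteEval_newtonPoly_self (l : ℕ → R) (c : ℕ) :
    hermiteEval l c (newtonPoly (fun i => l (i / 2)) c) =
      ∏ i ∈ Finset.range (c / 2), (l (c / 2) - l i) ^ 2 := by
  rcases Nat.even_or_odd' c with ⟨m, rfl | rfl⟩
  · simp [hermiteEval, leval_apply, eval_newtonPoly_doubled]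
  · have h : newtonPoly (fun i => l (i / 2)) (2 * m + 1) =
        newtonPoly (fun i => l (i / 2)) (2 * m) * (X - C (l m)) := by
      simp [newtonPoly, Finset.prod_range_succ]
    simp [h, hermiteEval, leval_apply, show (2 * m + 1) / 2 = m by omega, derivative_mul,
      eval_newtonPoly_doubled]

/-- The confluent alternant with exponents `E` factors through the Newton basis. -/
theorem hermiteEval_matrix_eq_mul (l : ℕ → R) {n : ℕ} (E : Fin n → ℕ) :
    (Matrix.of fun r c : Fin n => hermiteEval l c (X ^ E r)) =
      (Matrix.of fun r k : Fin n => newtonCoeff (fun i => l (i / 2)) (E r) k) *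
        Matrix.of fun k c : Fin n => hermiteEval l c (newtonPoly (fun i => l (i / 2)) k) := by
  ext r c
  rw [Matrix.mul_apply]
  simp only [Matrix.of_apply]
  rw [X_pow_eq_sum_newtonPoly (fun i => l (i / 2)) (E r) (show E r < n + (E r + 1) by omega),
    map_sum, Finset.sum_range_add, Finset.sum_range]
  simp only [← smul_eq_C_mul, map_smul, smul_eq_mul]
  rw [add_eq_left]
  refine Finset.sum_eq_zero fun k _ => ?_
  rw [hermiteEval_newtonPoly_eq_zero l (by omega), mul_zero]

theorem det_hermiteEval_newtonPoly (l : ℕ → R) (N : ℕ) :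
    (Matrix.of fun k c : Fin (2 * N) =>
      hermiteEval l c (newtonPoly (fun i => l (i / 2)) k)).det =
      ∏ m ∈ Finset.range N, ∏ i ∈ Finset.range m, (l i - l m) ^ 4 := by
  rw [Matrix.det_of_isUpperTriangular]
  · simp only [Matrix.of_apply, hermiteEval_newtonPoly_self]
    rw [Finset.prod_range
      (fun c => ∏ i ∈ Finset.range (c / 2), (l (c / 2) - l i) ^ 2) |>.symm,
      prod_range_two_mul_div_two (fun m => ∏ i ∈ Finset.range m, (l m - l i) ^ 2)]
    refine Finset.prod_congr rfl fun m _ => ?_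
    rw [← Finset.prod_pow]
    refine Finset.prod_congr rfl fun i _ => ?_
    ring
  · intro k c h
    exact hermiteEval_newtonPoly_eq_zero l h

theorem det_newtonCoeff (x : ℕ → R) {n : ℕ} (hn : 0 < n) (j : ℕ) :
    (Matrix.of fun r k : Fin n =>
      newtonCoeff x (if r.val < n - 1 then r.val else n + j - 1) k).det =
      newtonCoeff x (n - 1 + j) (n - 1) := by
  rw [Matrix.det_of_isLowerTriangular]
  · rw [Finset.prod_eq_single (⟨n - 1, by omega⟩ : Fin n)]
    · simp [show n + j - 1 = n - 1 + j by omega]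
    · intro r _ hr
      have : r.val ≠ n - 1 := fun h => hr (Fin.ext h)
      simp [show r.val < n - 1 by omega, newtonCoeff_self]
    · simp
  · intro r k h
    have h : r.val < k.val := h
    simp only [Matrix.of_apply]
    rw [if_pos (by omega), newtonCoeff_eq_zero x h]

end Newton

theorem hpoly_zero_right (n : ℕ) (x : Fin n → ℝ) : hpoly n 0 x = 1 := by
  simp [hpoly, Finset.Nat.antidiagonalTuple_zero_right]

theorem hpoly_succ_left (n j : ℕ) (x : Fin (n + 1) → ℝ) :
    hpoly (n + 1) j x =
      ∑ a ∈ Finset.HasAntidiagonal.antidiagonal j, x 0 ^ a.1 * hpoly n a.2 (fun i => x i.succ) := by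
  simp only [hpoly, Finset.mul_sum]
  rw [Finset.sum_sigma' (Finset.HasAntidiagonal.antidiagonal j)]
  symm
  refine Finset.sum_bij (fun p _ => Fin.cons p.1.1 p.2) ?_ ?_ ?_ ?_
  · rintro ⟨⟨a, b⟩, d⟩ h
    simp only [Finset.mem_sigma, Finset.HasAntidiagonal.mem_antidiagonal,
      Finset.Nat.mem_antidiagonalTuple] at h ⊢
    rw [Fin.sum_cons, h.2, h.1]
  · rintro ⟨⟨a, b⟩, d⟩ h ⟨⟨a', b'⟩, d'⟩ h' heq
    simp only [Finset.mem_sigma, Finset.HasAntidiagonal.mem_antidiagonal,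
      Finset.Nat.mem_antidiagonalTuple] at h h'
    obtain ⟨rfl, rfl⟩ := Fin.cons_inj.mp heq
    obtain rfl : b = b' := h.2.symm.trans h'.2
    rfl
  · intro d hd
    rw [Finset.Nat.mem_antidiagonalTuple, Fin.sum_univ_succ] at hd
    exact ⟨⟨(d 0, ∑ i : Fin n, d i.succ), fun i => d i.succ⟩,
      by simp [hd, Finset.Nat.mem_antidiagonalTuple], Fin.cons_self_tail d⟩
  · rintro ⟨⟨a, b⟩, d⟩ h
    simp [Fin.prod_univ_succ]

theorem hpoly_succ_succ (n j : ℕ) (x : Fin (n + 1) → ℝ) :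
    hpoly (n + 1) (j + 1) x =
      hpoly n (j + 1) (fun i => x i.succ) + x 0 * hpoly (n + 1) j x := by
  rw [hpoly_succ_left, hpoly_succ_left, Finset.Nat.sum_antidiagonal_succ, Finset.mul_sum]
  simp only [pow_zero, one_mul, pow_succ', mul_assoc]

theorem hpoly_comp_rev (n j : ℕ) (x : Fin n → ℝ) : hpoly n j (fun i => x i.rev) = hpoly n j x := by
  unfold hpoly
  refine Finset.sum_equiv (Fin.revPerm.arrowCongr (Equiv.refl ℕ)) (fun d => ?_) fun d _ => ?_
  · simp only [Finset.Nat.mem_antidiagonalTuple]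
    rw [← Equiv.sum_comp Fin.revPerm]
    rfl
  · rw [← Equiv.prod_comp Fin.revPerm]
    simp [Equiv.arrowCongr]

theorem newtonCoeff_add_left (x : ℕ → ℝ) (k j : ℕ) :
    newtonCoeff x (k + j) k = hpoly (k + 1) j (fun i => x (k - i)) := by
  induction j generalizing k with
  | zero => rw [add_zero, newtonCoeff_self, hpoly_zero_right]
  | succ j ihj =>
    induction k with
    | zero =>
      rw [hpoly_succ_succ, ← ihj, ← add_assoc, newtonCoeff]
      simp [hpoly]
    | succ k ihk =>
      rw [hpoly_succ_succ, ← ihj, ← add_assoc, newtonCoeff,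
        show k + 1 + j = k + (j + 1) by ring, ihk]
      simp

theorem newtonCoeff_eq_hpoly (x : ℕ → ℝ) {n : ℕ} (hn : 0 < n) (j : ℕ) :
    newtonCoeff x (n - 1 + j) (n - 1) = hpoly n j (fun i => x i) := by
  obtain ⟨n, rfl⟩ := Nat.exists_eq_succ_of_ne_zero hn.ne'
  rw [Nat.succ_eq_add_one, Nat.add_sub_cancel, newtonCoeff_add_left, ← hpoly_comp_rev]
  congr 1
  ext i
  congr 1
  simp only [Fin.val_rev]
  omega

theorem prod_filter_fst_lt_snd {M : Type*} [CommMonoid M] (N : ℕ) (f : ℕ → ℕ → M) :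
    ∏ p ∈ Finset.univ.filter (fun p : Fin N × Fin N => p.1 < p.2), f p.1 p.2 =
      ∏ m ∈ Finset.range N, ∏ i ∈ Finset.range m, f i m := by
  rw [Finset.prod_filter, ← Finset.univ_product_univ, Finset.prod_product_right, Finset.prod_range]
  refine Finset.prod_congr rfl fun m _ => ?_
  simp only [Fin.lt_def]
  rw [← Finset.prod_range (fun i => if i < m.val then f i m else 1), ← Finset.prod_filter]
  refine Finset.prod_congr ?_ fun _ _ => rfl
  ext i
  simp only [Finset.mem_filter, Finset.mem_range]
  omega

theorem stmt0 (N j : ℕ) (hN : 1 ≤ N) (lam : Fin N → ℝ)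
    (hlam : Function.Injective lam) :
    Matrix.det (Matrix.of (fun r c : Fin (2*N) =>
      if c.val % 2 = 0 then
        lam ⟨c.val / 2, by have := c.isLt; omega⟩ ^
          (if r.val < 2*N - 1 then r.val else 2*N + j - 1)
      else
        ((if r.val < 2*N - 1 then r.val else 2*N + j - 1 : ℕ) : ℝ) *
          lam ⟨c.val / 2, by have := c.isLt; omega⟩ ^
            ((if r.val < 2*N - 1 then r.val else 2*N + j - 1) - 1))) =
    hpoly (2*N) j (fun i => lam ⟨i.val / 2, by have := i.isLt; omega⟩) *
      ∏ p ∈ Finset.univ.filter (fun p : Fin N × Fin N => p.1 < p.2),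
        (lam p.1 - lam p.2) ^ 4 := by
  set l : ℕ → ℝ := fun i => if h : i < N then lam ⟨i, h⟩ else 0
  have hl (i : ℕ) (h : i < N) : lam ⟨i, h⟩ = l i := by simp [l, h]
  have hA := hermiteEval_matrix_eq_mul l
    (fun r : Fin (2 * N) => if r.val < 2 * N - 1 then r.val else 2 * N + j - 1)
  simp only [hermiteEval_X_pow] at hA
  simp only [hl]
  rw [hA, Matrix.det_mul, det_newtonCoeff _ (by omega), det_hermiteEval_newtonPoly,
    newtonCoeff_eq_hpoly _ (by omega), prod_filter_fst_lt_snd N (fun i m => (l i - l m) ^ 4)]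
end

section
/- Fix a real γ ≥ 1 with γ² rational, a real a with a > γ^{−1}, and a real ε > 0. For a pair of positive integers (M, N) with M = γ²N, set α = 2(M−N), define φ_{2N−1}(x) = e^{(a/(1+a))·2Mx} − (1+a)^{α+1} ∑_{j=0}^{2N−2} (−a)^j L_j^{(α)}(2Mx), ψ_{2N−1}(x) = φ_{2N−1}(x) · x^{M−N+1/2} e^{−Mx}, and y_M(η) = (a+1)(1 + 1/(γ²a)) + (a+1)√(1 − 1/(γ²a²)) · η/√(2M). Then for every real T: ∫_T^∞ | ( γ²a / ( (γ²a+1)(a+1) ) )^{M−N+1/2} · e^{M−N} · e^{ −( (γ²a²−1) / ( (γ²a+1)(a+1) ) ) M y_M(η) } · e^{−εη} · ψ_{2N−1}(y_M(η)) − e^{ −(1/4) ( (γ²a²−1)(γ²−1) / (γ²a+1)² ) η² − εη } |² dη → 0 as M → ∞ along pairs (M, N) with M = γ²N. -/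
open MeasureTheory

/-- Generalized Laguerre polynomial `L_n^{(α)}`. -/
noncomputable def Lag (n α : ℕ) (x : ℝ) : ℝ :=
  ∑ k ∈ Finset.range (n+1),
    (-1:ℝ)^k * (Nat.choose (n+α) (n-k) : ℝ) * x^k / (Nat.factorial k : ℝ)

/-- The function `φ_{2N-1}`. -/
noncomputable def phi (M N : ℕ) (a : ℝ) (x : ℝ) : ℝ :=
  Real.exp (a/(1+a) * (2*(M:ℝ)*x)) -
    (1+a)^(2*(M-N)+1) * ∑ j ∈ Finset.range (2*N-1), (-a)^j * Lag j (2*(M-N)) (2*(M:ℝ)*x)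

/-- The function `ψ_{2N-1}`. -/
noncomputable def psi (M N : ℕ) (a : ℝ) (x : ℝ) : ℝ :=
  phi M N a x * x ^ ((M:ℝ) - (N:ℝ) + 1/2) * Real.exp (-(M:ℝ)*x)

/-- The rescaled spectral variable in the supercritical case. -/
noncomputable def yM (γ a : ℝ) (M : ℕ) (η : ℝ) : ℝ :=
  (a+1)*(1 + 1/(γ^2*a)) + (a+1)*Real.sqrt (1 - 1/(γ^2*a^2)) * η / Real.sqrt (2*(M:ℝ))

/-- The generating function of the generalized Laguerre polynomials. -/
theorem hasSum_Lag_mul_pow (α : ℕ) (x : ℝ) {z : ℂ} (hz : ‖z‖ < 1) :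
    HasSum (fun n : ℕ => (Lag n α x : ℂ) * z ^ n)
      (((1 - z) ^ (α + 1))⁻¹ * Complex.exp (-(x * (z / (1 - z))))) := by
  set f : ℕ × ℕ → ℂ := fun p =>
    ((-(x * z)) ^ p.1 / (p.1.factorial : ℂ)) * (((p.2 + (α + p.1)).choose (α + p.1) : ℂ) * z ^ p.2)
    with hf
  have inner : ∀ k : ℕ, HasSum (fun m => f (k, m))
      (((-(x * z)) ^ k / (k.factorial : ℂ)) * (1 / (1 - z) ^ (α + k + 1))) := by
    intro k
    have := (hasSum_choose_mul_geometric_of_norm_lt_one (α + k) hz).mul_left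
      ((-(x * z)) ^ k / (k.factorial : ℂ))
    exact this.congr_fun fun m => by simp only [hf]
  have hz1 : (1 - z) ≠ 0 := by
    intro h
    have : z = 1 := by linear_combination -h
    simp [this] at hz
  have hr1 : 0 < 1 - ‖z‖ := by linarith
  have summ : Summable f := by
    rw [← summable_norm_iff, summable_prod_of_nonneg (fun _ => norm_nonneg _)]
    have innern : ∀ k : ℕ, HasSum (fun m => ‖f (k, m)‖)
      (((|x| * ‖z‖) ^ k / (k.factorial : ℝ)) * (1 / (1 - ‖z‖) ^ (α + k + 1))) := by
      intro k
      have := (hasSum_choose_mul_geometric_of_norm_lt_one (𝕜 := ℝ) (r := ‖z‖) (α + k)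
        (by simpa using hz)).mul_left ((|x| * ‖z‖) ^ k / (k.factorial : ℝ))
      refine this.congr_fun fun m => ?_
      simp [hf]
    refine ⟨fun k => (innern k).summable, ?_⟩
    simp_rw [fun k => (innern k).tsum_eq]
    have := (Real.summable_pow_div_factorial (|x| * ‖z‖ / (1 - ‖z‖))).mul_left
      (1 / (1 - ‖z‖) ^ (α + 1))
    refine this.congr fun k => ?_
    rw [div_pow, show α + k + 1 = α + 1 + k by ring, pow_add _ (α + 1)]
    field_simp
  have tot : HasSum f (((1 - z) ^ (α + 1))⁻¹ * Complex.exp (-(x * (z / (1 - z))))) := by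
    have h1 := summ.hasSum
    have h2 := h1.prod_fiberwise inner
    have h3 := (NormedSpace.expSeries_div_hasSum_exp (-(x * (z / (1 - z))) : ℂ)).mul_left
      (((1 - z) ^ (α + 1))⁻¹)
    rw [← Complex.exp_eq_exp_ℂ] at h3
    have : ∑' p, f p = ((1 - z) ^ (α + 1))⁻¹ * Complex.exp (-(x * (z / (1 - z)))) := by
      refine h2.unique (h3.congr_fun fun k => ?_)
      rw [show -(x * (z / (1 - z))) = (-(x * z)) / (1 - z) by ring, div_pow,
        show α + k + 1 = α + 1 + k by ring, pow_add _ (α + 1)]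
      field_simp
    rwa [this] at h1
  have h4 := (Finset.HasAntidiagonal.sigmaAntidiagonalEquivProd.hasSum_iff.mpr tot).sigma
    (fun n => hasSum_fintype _)
  refine h4.congr_fun fun n => ?_
  rw [Finset.univ_eq_attach, ← Finset.sum_coe_sort_eq_attach]
  simp only [Function.comp_def, Finset.HasAntidiagonal.sigmaAntidiagonalEquivProd_apply]
  rw [Finset.sum_coe_sort (Finset.HasAntidiagonal.antidiagonal n) f,
    Finset.Nat.sum_antidiagonal_eq_sum_range_succ_mk, Lag]
  push_cast
  rw [Finset.sum_mul]
  refine Finset.sum_congr rfl fun k hk => ?_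
  have hk' : k ≤ n := by simpa [Nat.lt_succ_iff] using hk
  have hc : (n - k + (α + k)).choose (α + k) = (n + α).choose (n - k) := by
    rw [show n - k + (α + k) = n + α by omega]
    exact Nat.choose_symm_of_eq_add (by omega)
  have hzn : z ^ n = z ^ k * z ^ (n - k) := by rw [← pow_add]; congr 1; omega
  simp only [hf, hc, hzn]
  rw [neg_pow (x * z : ℂ), mul_pow (x : ℂ) z]
  ring

theorem norm_Lag_generating_le {α : ℕ} {x r : ℝ} (hr0 : 0 < r) (hr1 : r < 1)
    (hx : (α + 1) * (1 + r) ≤ x * (1 - r)) {z : ℂ} (hz : ‖z‖ = r) :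
    ‖((1 - z) ^ (α + 1))⁻¹ * Complex.exp (-(x * (z / (1 - z))))‖ ≤
      ((1 + r) ^ (α + 1))⁻¹ * Real.exp (x * (r / (1 + r))) := by
  set t := ‖1 - z‖ with ht
  have ht0 : 0 < t := by
    have := norm_sub_norm_le (1 : ℂ) z
    rw [norm_one, hz] at this
    linarith
  have ht1 : t ≤ 1 + r := by
    have := norm_sub_le (1 : ℂ) z
    rw [norm_one, hz] at this
    exact this
  have hsq : t ^ 2 = (1 - z.re) ^ 2 + z.im ^ 2 := by
    rw [ht, Complex.sq_norm, Complex.normSq_apply]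
    simp
    ring
  have hsqz : r ^ 2 = z.re ^ 2 + z.im ^ 2 := by
    rw [← hz, Complex.sq_norm, Complex.normSq_apply]
    ring
  have hre : (z / (1 - z)).re = (1 - r ^ 2 - t ^ 2) / (2 * t ^ 2) := by
    rw [Complex.div_re, ← Complex.sq_norm, ← ht]
    simp only [Complex.sub_re, Complex.one_re, Complex.sub_im, Complex.one_im]
    rw [← add_div, div_eq_div_iff (by positivity) (by positivity)]
    linear_combination t ^ 2 * (hsqz + hsq)
  rw [norm_mul, norm_inv, norm_pow, ← ht, Complex.norm_exp]
  have hre2 : (-((x : ℂ) * (z / (1 - z)))).re = -(x * ((1 - r ^ 2 - t ^ 2) / (2 * t ^ 2))) := by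
    rw [Complex.neg_re, Complex.re_ofReal_mul, hre]
  rw [hre2]
  set w := (1 + r) / t with hw
  have hw1 : 1 ≤ w := by rw [hw, one_le_div ht0]; exact ht1
  have hw2 : w ^ 2 ≤ Real.exp (w ^ 2 - 1) := by
    have := Real.add_one_le_exp (w ^ 2 - 1)
    linarith
  have hw3 : w ≤ Real.exp ((w ^ 2 - 1) / 2) := by
    refine (sq_le_sq₀ (by positivity) (Real.exp_pos _).le).mp ?_
    rw [← Real.exp_nat_mul]
    refine hw2.trans (le_of_eq ?_)
    congr 1
    push_cast
    ring
  have hw4 : w ^ (α + 1) ≤ Real.exp (x * (1 - r) / (1 + r) * ((w ^ 2 - 1) / 2)) := by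
    calc w ^ (α + 1) ≤ (Real.exp ((w ^ 2 - 1) / 2)) ^ (α + 1) := by gcongr
      _ = Real.exp ((α + 1) * ((w ^ 2 - 1) / 2)) := by
        rw [← Real.exp_nat_mul]; push_cast; rfl
      _ ≤ _ := by
        apply Real.exp_le_exp.mpr
        apply mul_le_mul_of_nonneg_right
        · rw [le_div_iff₀ (by linarith)]; exact hx
        · nlinarith
  have htw : t = (1 + r) / w := by rw [hw]; field_simp
  have hwp : 0 < w := by linarith
  have e1 : -(x * ((1 - r ^ 2 - t ^ 2) / (2 * t ^ 2))) =
      x * (r / (1 + r)) - x * (1 - r) / (1 + r) * ((w ^ 2 - 1) / 2) := by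
    rw [hw]
    field_simp
    ring
  rw [e1, Real.exp_sub, htw, div_pow, inv_div]
  have := Real.exp_pos (x * (1 - r) / (1 + r) * ((w ^ 2 - 1) / 2))
  rw [div_mul_div_comm, inv_mul_eq_div, div_le_div_iff₀ (by positivity) (by positivity)]
  have h5 := mul_le_mul_of_nonneg_right hw4
    (show 0 ≤ Real.exp (x * (r / (1 + r))) * (1 + r) ^ (α + 1) by positivity)
  linarith

/-- A Cauchy estimate for Laguerre polynomials to the right of the oscillatory region. -/
theorem abs_Lag_le {α : ℕ} {x r : ℝ} (hr0 : 0 < r) (hr1 : r < 1)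
    (hx : (α + 1) * (1 + r) ≤ x * (1 - r)) (n : ℕ) :
    |Lag n α x| ≤ ((1 + r) ^ (α + 1))⁻¹ * Real.exp (x * (r / (1 + r))) / r ^ n := by
  set g : ℂ → ℂ := fun z => ((1 - z) ^ (α + 1))⁻¹ * Complex.exp (-(x * (z / (1 - z)))) with hg
  have hd : DifferentiableOn ℂ g (Metric.ball 0 1) := by
    intro z hz
    have h1 : (1 : ℂ) - z ≠ 0 := by
      intro h
      have : z = 1 := by linear_combination -h
      simp [this] at hz
    apply DifferentiableAt.differentiableWithinAt
    have h2 : (1 - z) ^ (α + 1) ≠ 0 := pow_ne_zero _ h1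
    fun_prop (disch := assumption)
  have hcoef : (Lag n α x : ℂ) = (n.factorial : ℂ)⁻¹ * iteratedDeriv n g 0 := by
    have p1 : HasFPowerSeriesAt g
        (FormalMultilinearSeries.ofScalars ℂ (fun n => (Lag n α x : ℂ))) 0 := by
      rw [hasFPowerSeriesAt_iff]
      filter_upwards [Metric.ball_mem_nhds (0 : ℂ) one_pos] with z hz
      rw [zero_add]
      refine (hasSum_Lag_mul_pow α x (by simpa using hz)).congr_fun fun n => ?_
      simp [mul_comm]
    have p2 : HasFPowerSeriesAt g
        (FormalMultilinearSeries.ofScalars ℂ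
          (fun n => (n.factorial : ℂ)⁻¹ * iteratedDeriv n g 0)) 0 := by
      rw [hasFPowerSeriesAt_iff]
      filter_upwards [Metric.ball_mem_nhds (0 : ℂ) one_pos] with z hz
      rw [zero_add]
      refine (Complex.hasSum_taylorSeries_on_ball hd hz).congr_fun fun n => ?_
      simp
      ring
    have := congrArg (fun p => p.coeff n) (p1.eq_formalMultilinearSeries p2)
    simpa using this
  have hcl : DiffContOnCl ℂ g (Metric.ball 0 r) :=
    (hd.mono (Metric.closedBall_subset_ball hr1)).diffContOnCl_ball subset_rfl
  have hb := Complex.norm_iteratedDeriv_le_of_forall_mem_sphere_norm_le n hr0 hcl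
    (fun z hz => norm_Lag_generating_le hr0 hr1 hx (by simpa using hz))
  rw [← Real.norm_eq_abs, ← Complex.norm_real, hcoef, norm_mul, norm_inv, Complex.norm_natCast,
    inv_mul_le_iff₀ (by positivity)]
  rw [mul_div_assoc] at hb
  exact hb

theorem abs_sum_Lag_le {α : ℕ} {x r a : ℝ} (hr0 : 0 < r) (hr1 : r < 1) (hra : r < a)
    (hx : (α + 1) * (1 + r) ≤ x * (1 - r)) (n : ℕ) :
    |∑ j ∈ Finset.range n, (-a) ^ j * Lag j α x| ≤
      ((1 + r) ^ (α + 1))⁻¹ * Real.exp (x * (r / (1 + r))) * ((a / r) ^ n / (a / r - 1)) := by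
  have hq : 1 < a / r := (one_lt_div hr0).mpr hra
  have ha0 : 0 < a := hr0.trans hra
  calc |∑ j ∈ Finset.range n, (-a) ^ j * Lag j α x|
      ≤ ∑ j ∈ Finset.range n, |(-a) ^ j * Lag j α x| := Finset.abs_sum_le_sum_abs _ _
    _ ≤ ∑ j ∈ Finset.range n,
          ((1 + r) ^ (α + 1))⁻¹ * Real.exp (x * (r / (1 + r))) * (a / r) ^ j := by
        refine Finset.sum_le_sum fun j _ => ?_
        rw [abs_mul, abs_pow, abs_neg, abs_of_pos ha0, div_pow]
        calc a ^ j * |Lag j α x| ≤ a ^ j *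
              (((1 + r) ^ (α + 1))⁻¹ * Real.exp (x * (r / (1 + r))) / r ^ j) := by
              gcongr
              exact abs_Lag_le hr0 hr1 hx j
          _ = _ := by ring
    _ = ((1 + r) ^ (α + 1))⁻¹ * Real.exp (x * (r / (1 + r))) *
          (((a / r) ^ n - 1) / (a / r - 1)) := by
        rw [← Finset.mul_sum, geom_sum_eq hq.ne']
    _ ≤ _ := by
        have : 0 < a / r - 1 := by linarith
        gcongr
        linarith

/-- Strict positivity of the exponential rate at which the truncation error decays. -/
theorem truncation_rate_pos {G a b : ℝ} (hb : 0 < b) (hba : b < a) (hab : G * a * b = 1) :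
    0 < 1 / b - 1 / a - (Real.log a - Real.log b)
      - (G - 1) * (Real.log (1 + a) - Real.log (1 + b)) := by
  have ha : 0 < a := hb.trans hba
  have hG : G = 1 / (a * b) := by field_simp; linarith
  set F : ℝ → ℝ := fun t =>
    Real.log t + (G - 1) * Real.log (1 + t) + (1 + a) * (1 + b) / (a * b) / (1 + t)
    with hF
  have hder : ∀ t : ℝ, 0 < t → HasDerivAt F
      (1 / t + (G - 1) * (1 / (1 + t)) +
        (0 * (1 + t) - (1 + a) * (1 + b) / (a * b) * 1) / (1 + t) ^ 2) t := by
    intro t ht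
    have h1 : HasDerivAt (fun t : ℝ => 1 + t) 1 t := (hasDerivAt_id t).const_add 1
    have h2 : (1 + t) ≠ 0 := by positivity
    exact ((by simpa using Real.hasDerivAt_log ht.ne' : HasDerivAt Real.log (1 / t) t).add
      ((h1.log h2).const_mul (G - 1))).add ((hasDerivAt_const t _).div h1 h2)
  have hanti : StrictAntiOn F (Set.Icc b a) := by
    refine strictAntiOn_of_deriv_neg (convex_Icc b a)
      (fun t ht => (hder t (hb.trans_le ht.1)).continuousAt.continuousWithinAt) fun t ht => ?_
    rw [interior_Icc] at ht
    have ht0 : 0 < t := hb.trans ht.1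
    rw [(hder t ht0).deriv]
    have : 1 / t + (G - 1) * (1 / (1 + t)) +
        (0 * (1 + t) - (1 + a) * (1 + b) / (a * b) * 1) / (1 + t) ^ 2
        = -((a - t) * (t - b) / (a * b * t * (1 + t) ^ 2)) := by
      rw [hG]
      field_simp
      ring
    rw [this, neg_lt_zero]
    have h1 := sub_pos.mpr ht.1
    have h2 := sub_pos.mpr ht.2
    positivity
  have := hanti ⟨le_rfl, hba.le⟩ ⟨hba.le, le_rfl⟩ hba
  have e : (1 + a) * (1 + b) / (a * b) / (1 + b) - (1 + a) * (1 + b) / (a * b) / (1 + a)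
      = 1 / b - 1 / a := by
    field_simp
    ring
  simp only [hF] at this
  linarith

/-- The relative truncation error of the Laguerre generating function. -/
noncomputable def truncErr (M N : ℕ) (a x : ℝ) : ℝ :=
  (1+a)^(2*(M-N)+1) * (∑ j ∈ Finset.range (2*N-1), (-a)^j * Lag j (2*(M-N)) (2*(M:ℝ)*x)) *
    Real.exp (-(a/(1+a) * (2*(M:ℝ)*x)))

theorem phi_eq_exp_mul (M N : ℕ) (a x : ℝ) :
    phi M N a x = Real.exp (a/(1+a) * (2*(M:ℝ)*x)) * (1 - truncErr M N a x) := by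
  have h : Real.exp (a/(1+a) * (2*(M:ℝ)*x)) * Real.exp (-(a/(1+a) * (2*(M:ℝ)*x))) = 1 := by
    rw [← Real.exp_add, add_neg_cancel, Real.exp_zero]
  rw [phi, truncErr]
  linear_combination ((1+a)^(2*(M-N)+1) *
    ∑ j ∈ Finset.range (2*N-1), (-a)^j * Lag j (2*(M-N)) (2*(M:ℝ)*x)) * h

theorem abs_truncErr_le {G a b : ℝ} (hG : 1 ≤ G) (hb : 0 < b) (hba : b < a)
    (hab : G * a * b = 1) {M N : ℕ} (hM : (M : ℝ) = G * N) {y : ℝ}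
    (hy : (2 * (G - 1) * N + 1) * (1 + b) ≤ 2 * G * N * y * (1 - b)) :
    |truncErr M N a y| ≤ (1 + a) / (1 + b) / (a / b - 1) *
      Real.exp (-(2 * N * (1 / b - 1 / a - (Real.log a - Real.log b)
        - (G - 1) * (Real.log (1 + a) - Real.log (1 + b))))
        - (a - b) / ((1 + a) * (1 + b)) * (2 * G * N * (y - (1 + a) * (1 + b)))) := by
  have ha : 0 < a := hb.trans hba
  have hb1 : b < 1 := by
    by_contra! h
    nlinarith [mul_pos ha hb, mul_le_mul hG h zero_le_one (by linarith)]
  have hN : (0 : ℝ) ≤ N := N.cast_nonneg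
  have hNM : N ≤ M := by
    have : (N : ℝ) ≤ M := by rw [hM]; nlinarith
    exact_mod_cast this
  have hα : ((2 * (M - N) : ℕ) : ℝ) = 2 * (G - 1) * N := by
    push_cast [Nat.cast_sub hNM]
    rw [hM]; ring
  have hx : (((2 * (M - N) : ℕ) : ℝ) + 1) * (1 + b) ≤ 2 * (M : ℝ) * y * (1 - b) := by
    rw [hα, hM]
    linarith
  have hq : 1 < a / b := (one_lt_div hb).mpr hba
  have hq0 : 0 < a / b - 1 := by linarith
  have key := abs_sum_Lag_le hb hb1 hba hx (2 * N - 1)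
  have hpow : (a / b) ^ (2 * N - 1) ≤ Real.exp (2 * N * (Real.log a - Real.log b)) := by
    calc (a / b) ^ (2 * N - 1) ≤ (a / b) ^ (2 * N) := pow_le_pow_right₀ hq.le (Nat.sub_le _ _)
      _ = _ := by
        rw [← Real.log_div ha.ne' hb.ne', ← Real.exp_log (pow_pos (by positivity) (2 * N)),
          Real.log_pow]
        push_cast
        rfl
  have hpow2 : ((1 + a) / (1 + b)) ^ (2 * (M - N)) =
      Real.exp (2 * (G - 1) * N * (Real.log (1 + a) - Real.log (1 + b))) := by
    rw [← Real.log_div (by positivity) (by positivity), ← hα, ← Real.log_pow,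
      Real.exp_log (by positivity)]
  rw [truncErr, abs_mul, abs_mul, abs_of_pos (Real.exp_pos _), abs_of_pos (by positivity)]
  calc _ ≤ (1 + a) ^ (2 * (M - N) + 1) * (((1 + b) ^ (2 * (M - N) + 1))⁻¹ *
        Real.exp (2 * (M : ℝ) * y * (b / (1 + b))) *
        (Real.exp (2 * N * (Real.log a - Real.log b)) / (a / b - 1))) *
        Real.exp (-(a/(1+a) * (2*(M:ℝ)*y))) := by
        gcongr
        refine key.trans ?_
        gcongr
    _ = (1 + a) / (1 + b) / (a / b - 1) * (((1 + a) / (1 + b)) ^ (2 * (M - N)) *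
        Real.exp (2 * (M : ℝ) * y * (b / (1 + b))) *
        Real.exp (2 * N * (Real.log a - Real.log b)) * Real.exp (-(a/(1+a) * (2*(M:ℝ)*y)))) := by
        rw [div_pow, pow_succ, pow_succ]
        field_simp
    _ = _ := by
        rw [hpow2, ← Real.exp_add, ← Real.exp_add, ← Real.exp_add, hM]
        congr 2
        have hG' : G = 1 / (a * b) := by field_simp; linarith
        rw [hG']
        field_simp
        ring

theorem eventually_sqrt_add_le {p : ℝ} (hp : 0 < p) (q s : ℝ) :
    ∀ᶠ N : ℕ in Filter.atTop, q * √(N : ℝ) + s ≤ p * N := by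
  have h1 : Filter.Tendsto (fun N : ℕ => √(N : ℝ)) Filter.atTop Filter.atTop :=
    Real.tendsto_sqrt_atTop.comp tendsto_natCast_atTop_atTop
  filter_upwards [h1.eventually_ge_atTop ((|q| + |s|) / p + 1)] with N hN
  have h2 : √(N : ℝ) * √(N : ℝ) = N := Real.mul_self_sqrt N.cast_nonneg
  have h3 : 0 ≤ (|q| + |s|) / p := by positivity
  have h4 : |q| + |s| ≤ p * √(N : ℝ) := by
    rw [← div_le_iff₀' hp]
    linarith
  have h5 : 1 ≤ √(N : ℝ) := by linarith
  have h6 := mul_le_mul_of_nonneg_right h4 (by linarith : 0 ≤ √(N : ℝ))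
  nlinarith [le_abs_self q, le_abs_self s, abs_nonneg s, abs_nonneg q]

/-- The relative truncation error vanishes uniformly on the region starting `O(√N)` to the left
of the outlier position. -/
theorem exists_tendsto_zero_abs_truncErr_le {G a b : ℝ} (hG : 1 ≤ G) (hb : 0 < b) (hba : b < a)
    (hab : G * a * b = 1) (q : ℝ) :
    ∃ ρ : ℕ → ℝ, Filter.Tendsto ρ Filter.atTop (nhds 0) ∧
      ∀ᶠ N : ℕ in Filter.atTop, ∀ M : ℕ, (M : ℝ) = G * N → ∀ y : ℝ,
        -(q * √(N : ℝ)) ≤ 2 * G * N * (y - (1 + a) * (1 + b)) →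
          0 < y ∧ |truncErr M N a y| ≤ ρ N := by
  have ha : 0 < a := hb.trans hba
  have hb1 : b < 1 := by
    by_contra! h
    nlinarith [mul_pos ha hb, mul_le_mul hG h zero_le_one (by linarith)]
  have hD := truncation_rate_pos hb hba hab
  set D := 1 / b - 1 / a - (Real.log a - Real.log b)
      - (G - 1) * (Real.log (1 + a) - Real.log (1 + b)) with hDdef
  set k := (a - b) / ((1 + a) * (1 + b)) with hk
  have hk0 : 0 < k := by
    have : 0 < a - b := by linarith
    positivity
  have hq0 : 0 < a / b - 1 := by
    have : 1 < a / b := (one_lt_div hb).mpr hba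
    linarith
  set C := (1 + a) / (1 + b) / (a / b - 1) with hC
  have hC0 : 0 < C := by positivity
  refine ⟨fun N => C * Real.exp (-(D * N)), ?_, ?_⟩
  · have h1 : Filter.Tendsto (fun N : ℕ => D * (N : ℝ)) Filter.atTop Filter.atTop :=
      tendsto_natCast_atTop_atTop.const_mul_atTop hD
    simpa using (Real.tendsto_exp_neg_atTop_nhds_zero.comp h1).const_mul C
  · have hp : 0 < 2 * (1 + b) * (G * (a - b)) := by
      have : 0 < a - b := by linarith
      positivity
    filter_upwards [eventually_sqrt_add_le hp (q * (1 - b)) (1 + b),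
      eventually_sqrt_add_le hD (k * q) 0, Filter.eventually_gt_atTop 0] with N h1 h2 hN0 M hM y hy
    have hN : (0 : ℝ) < N := by exact_mod_cast hN0
    have hcond : (2 * (G - 1) * N + 1) * (1 + b) ≤ 2 * G * N * y * (1 - b) := by
      have h3 := mul_le_mul_of_nonneg_right hy (by linarith : 0 ≤ 1 - b)
      have h4 : 2 * G * N * ((1 + a) * (1 + b)) * (1 - b) =
          2 * (1 + b) * (G * (a - b)) * N + 2 * (G - 1) * N * (1 + b) := by
        linear_combination (-2 * N * (1 + b)) * hab
      linarith
    refine ⟨?_, (abs_truncErr_le hG hb hba hab hM hcond).trans ?_⟩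
    · have h5 : 0 < (2 * (G - 1) * N + 1) * (1 + b) := by
        have : 0 ≤ G - 1 := by linarith
        positivity
      by_contra! hy0
      have : 2 * G * N * y * (1 - b) ≤ 0 :=
        mul_nonpos_of_nonpos_of_nonneg
          (mul_nonpos_of_nonneg_of_nonpos (by positivity) hy0) (by linarith)
      linarith
    · refine mul_le_mul_of_nonneg_left (Real.exp_le_exp.mpr ?_) hC0.le
      have h6 := mul_le_mul_of_nonneg_left hy hk0.le
      linarith

/-- Replacing the truncated sum by the generating function, the rescaled `ψ` is a Gamma-type
density around its maximum. -/
theorem rescaled_psi_eq {G a b : ℝ} (hb : 0 < b) (hba : b < a)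
    (hab : G * a * b = 1) {M N : ℕ} (hM : (M : ℝ) = G * N) {u : ℝ} (hu : 0 < 1 + u) :
    (G*a/((G*a+1)*(a+1))) ^ ((M:ℝ) - (N:ℝ) + 1/2) * Real.exp ((M:ℝ) - (N:ℝ)) *
      Real.exp (-((G*a^2-1)/((G*a+1)*(a+1))) * (M:ℝ) * ((1 + a) * (1 + b) * (1 + u))) *
      psi M N a ((1 + a) * (1 + b) * (1 + u)) =
    (1 + u) ^ ((M:ℝ) - (N:ℝ) + 1/2) * Real.exp (-(((M:ℝ) - (N:ℝ)) * u)) *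
      (1 - truncErr M N a ((1 + a) * (1 + b) * (1 + u))) := by
  have ha : 0 < a := hb.trans hba
  have hy0 : 0 < (1 + a) * (1 + b) := by positivity
  have hG' : G = 1 / (a * b) := by field_simp; linarith
  have e1 : G*a/((G*a+1)*(a+1)) = ((1 + a) * (1 + b))⁻¹ := by
    rw [hG']; field_simp; ring
  have e2 : ((1 + a) * (1 + b))⁻¹ ^ ((M:ℝ) - (N:ℝ) + 1/2) *
      ((1 + a) * (1 + b) * (1 + u)) ^ ((M:ℝ) - (N:ℝ) + 1/2) =
      (1 + u) ^ ((M:ℝ) - (N:ℝ) + 1/2) := by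
    rw [← Real.mul_rpow (by positivity) (by positivity)]
    congr 1
    field_simp
  have e3 : Real.exp ((M:ℝ) - (N:ℝ)) *
      Real.exp (-((G*a^2-1)/((G*a+1)*(a+1))) * (M:ℝ) * ((1 + a) * (1 + b) * (1 + u))) *
      Real.exp (a/(1+a) * (2*(M:ℝ)*((1 + a) * (1 + b) * (1 + u)))) *
      Real.exp (-(M:ℝ)*((1 + a) * (1 + b) * (1 + u))) = Real.exp (-(((M:ℝ) - (N:ℝ)) * u)) := by
    rw [← Real.exp_add, ← Real.exp_add, ← Real.exp_add, hM, hG']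
    congr 1
    field_simp
    ring
  rw [psi, phi_eq_exp_mul, e1, ← e2, ← e3]
  ring

theorem sq_rpow_mul_exp_le {K w : ℝ} (hK : 0 ≤ K) (hw : 0 < 1 + w) :
    ((1 + w) ^ (K + 1/2) * Real.exp (-(K * w))) ^ 2 ≤ 1 + w := by
  have h1 : 1 + w ≤ Real.exp w := by linarith [Real.add_one_le_exp w]
  have h2 : (1 + w) ^ K ≤ Real.exp (K * w) := by
    calc (1 + w) ^ K ≤ (Real.exp w) ^ K := Real.rpow_le_rpow hw.le h1 hK
      _ = _ := by rw [← Real.exp_mul, mul_comm]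
  have h3 : (1 + w) ^ K * Real.exp (-(K * w)) ≤ 1 := by
    rw [Real.exp_neg, ← div_eq_mul_inv, div_le_one (Real.exp_pos _)]
    exact h2
  have h4 : ((1 + w) ^ (1/2 : ℝ)) ^ 2 = 1 + w := by
    rw [← Real.sqrt_eq_rpow, Real.sq_sqrt hw.le]
  rw [Real.rpow_add hw]
  calc _ = ((1 + w) ^ K * Real.exp (-(K * w))) ^ 2 * ((1 + w) ^ (1/2 : ℝ)) ^ 2 := by ring
    _ ≤ 1 ^ 2 * (1 + w) := by
      rw [h4]
      gcongr
    _ = _ := by ring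

/-- Laplace-type limit of a rescaled Gamma density. -/
theorem tendsto_rpow_mul_exp_gaussian {ι : Type*} {l : Filter ι} {K u : ι → ℝ} {s : ℝ}
    (hu : Filter.Tendsto u l (nhds 0)) (hKu : Filter.Tendsto (fun i => K i * u i ^ 2) l (nhds s)) :
    Filter.Tendsto (fun i => (1 + u i) ^ (K i + 1/2) * Real.exp (-(K i * u i))) l
      (nhds (Real.exp (-(s / 2)))) := by
  have hlog : Filter.Tendsto (fun i => Real.log (1 + u i)) l (nhds 0) := by
    have h1 : Filter.Tendsto (fun i => 1 + u i) l (nhds 1) := by simpa using hu.const_add 1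
    simpa using h1.log one_ne_zero
  have hsmall : ∀ᶠ i in l, |u i| < 1 / 2 := by
    have := hu.abs
    rw [abs_zero] at this
    exact this.eventually_lt_const (by norm_num)
  have herr : Filter.Tendsto
      (fun i => K i * (Real.log (1 + u i) - u i + u i ^ 2 / 2)) l (nhds 0) := by
    have h0 : Filter.Tendsto (fun i => 2 * |K i * u i ^ 2| * |u i|) l (nhds 0) := by
      simpa using (hKu.abs.const_mul 2).mul hu.abs
    refine squeeze_zero_norm' ?_ h0
    filter_upwards [hsmall] with i hi
    have h1 := Real.abs_log_sub_add_sum_range_le (x := -u i) (by rw [abs_neg]; linarith) 2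
    rw [abs_neg] at h1
    have h2 : |Real.log (1 + u i) - u i + u i ^ 2 / 2| ≤ |u i| ^ 3 / (1 - |u i|) := by
      refine le_trans (le_of_eq ?_) h1
      congr 1
      simp [Finset.sum_range_succ]
      ring
    have h3 : |u i| ^ 3 / (1 - |u i|) ≤ 2 * |u i| ^ 3 := by
      rw [div_le_iff₀ (by linarith)]
      nlinarith [pow_nonneg (abs_nonneg (u i)) 3]
    rw [Real.norm_eq_abs, abs_mul]
    calc |K i| * |Real.log (1 + u i) - u i + u i ^ 2 / 2| ≤ |K i| * (2 * |u i| ^ 3) := by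
          gcongr
          exact h2.trans h3
      _ = _ := by rw [abs_mul, abs_pow]; ring
  have hexp : Filter.Tendsto (fun i => K i * (Real.log (1 + u i) - u i + u i ^ 2 / 2)
      - K i * u i ^ 2 / 2 + Real.log (1 + u i) / 2) l (nhds (-(s / 2))) := by
    simpa using (herr.sub (hKu.div_const 2)).add (hlog.div_const 2)
  refine ((Real.continuous_exp.tendsto _).comp hexp).congr' ?_
  filter_upwards [hsmall] with i hi
  have : 0 < 1 + u i := by linarith [neg_abs_le (u i)]
  rw [Real.rpow_def_of_pos this, ← Real.exp_add, Function.comp_apply]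
  congr 1
  ring

theorem continuous_Lag (n α : ℕ) : Continuous (Lag n α) := by
  unfold Lag
  fun_prop

theorem measurable_psi (M N : ℕ) (a : ℝ) : Measurable (psi M N a) := by
  have := fun j : ℕ => (continuous_Lag j (2*(M-N))).measurable
  unfold psi phi
  fun_prop

theorem tendsto_integral_rescaled_psi {G a b c κ ε : ℝ} (hG : 1 ≤ G) (hb : 0 < b) (hba : b < a)
    (hab : G * a * b = 1) (hc : 0 ≤ c) (hκ : κ = (1 - 1 / G) * c ^ 2) (hε : 0 < ε) (T : ℝ)
    {l : Filter (ℕ × ℕ)} [l.IsCountablyGenerated] (hl : Filter.Tendsto Prod.snd l Filter.atTop)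
    (hlM : ∀ᶠ p in l, (p.1 : ℝ) = G * p.2) :
    Filter.Tendsto (fun p : ℕ × ℕ => ∫ η in Set.Ioi T,
        ((G*a/((G*a+1)*(a+1))) ^ ((p.1:ℝ) - (p.2:ℝ) + 1/2) * Real.exp ((p.1:ℝ) - (p.2:ℝ)) *
            Real.exp (-((G*a^2-1)/((G*a+1)*(a+1))) * (p.1:ℝ) *
              ((1 + a) * (1 + b) * (1 + c * η / √(2 * (p.1:ℝ))))) *
            Real.exp (-ε*η) * psi p.1 p.2 a ((1 + a) * (1 + b) * (1 + c * η / √(2 * (p.1:ℝ))))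
          - Real.exp (-(1/4)*κ*η^2 - ε*η)) ^ 2) l (nhds 0) := by
  have ha : 0 < a := hb.trans hba
  have hG0 : 0 < G := by linarith
  have hκ0 : 0 ≤ κ := by
    have : 1 / G ≤ 1 := (div_le_one hG0).mpr hG
    rw [hκ]
    have : 0 ≤ 1 - 1 / G := by linarith
    positivity
  obtain ⟨ρ, hρ, hgood⟩ := exists_tendsto_zero_abs_truncErr_le hG hb hba hab
    ((1 + a) * (1 + b) * c * |T| * √(2 * G))
  have hNreal : Filter.Tendsto (fun p : ℕ × ℕ => (p.2 : ℝ)) l Filter.atTop :=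
    tendsto_natCast_atTop_atTop.comp hl
  set f : ℕ × ℕ → ℝ → ℝ := fun p η => (1 + c * η / √(2 * (p.1:ℝ))) ^ ((p.1:ℝ) - (p.2:ℝ) + 1/2) *
    Real.exp (-(((p.1:ℝ) - (p.2:ℝ)) * (c * η / √(2 * (p.1:ℝ))))) with hf
  set R : ℕ × ℕ → ℝ → ℝ := fun p η =>
    truncErr p.1 p.2 a ((1 + a) * (1 + b) * (1 + c * η / √(2 * (p.1:ℝ)))) with hR
  have hev : ∀ᶠ p in l, (p.1 : ℝ) = G * p.2 ∧ 1 ≤ p.1 ∧ p.2 ≤ p.1 ∧ ρ p.2 ≤ 1 ∧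
      ∀ η, T < η → 0 < 1 + c * η / √(2 * (p.1:ℝ)) ∧ |R p η| ≤ ρ p.2 := by
    filter_upwards [hlM, hl.eventually hgood, hl.eventually (hρ.eventually_le_const one_pos),
      hl.eventually_ge_atTop 1] with p hp hg h1 hp2
    have hle : p.2 ≤ p.1 := by
      have : (p.2 : ℝ) ≤ p.1 := by rw [hp]; nlinarith [(p.2.cast_nonneg : (0:ℝ) ≤ p.2)]
      exact_mod_cast this
    refine ⟨hp, hp2.trans hle, hle, h1, fun η hη => ?_⟩
    have hM0 : (0 : ℝ) < 2 * (p.1 : ℝ) := by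
      have : 0 < p.1 := hp2.trans hle
      positivity
    have hy0 : 0 < (1 + a) * (1 + b) := by positivity
    have key : -((1 + a) * (1 + b) * c * |T| * √(2 * G) * √(p.2:ℝ)) ≤
        2 * G * p.2 * ((1 + a) * (1 + b) * (1 + c * η / √(2 * (p.1:ℝ))) - (1 + a) * (1 + b)) := by
      have e1 : √(2 * G) * √(p.2:ℝ) = √(2 * (p.1:ℝ)) := by
        rw [← Real.sqrt_mul (by positivity), hp, mul_assoc]
      have e2 : 2 * G * p.2 = √(2 * (p.1:ℝ)) * √(2 * (p.1:ℝ)) := by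
        rw [Real.mul_self_sqrt hM0.le, hp]; ring
      have hs : 0 < √(2 * (p.1:ℝ)) := Real.sqrt_pos.mpr hM0
      have e3 : 2 * G * p.2 * ((1 + a) * (1 + b) * (1 + c * η / √(2 * (p.1:ℝ)))
          - (1 + a) * (1 + b)) = (1 + a) * (1 + b) * c * √(2 * (p.1:ℝ)) * η := by
        rw [e2]; field_simp; ring
      rw [e3, mul_assoc _ (√(2 * G)), e1]
      have h2 : -|T| ≤ η := (neg_abs_le T).trans hη.le
      have h3 : 0 ≤ (1 + a) * (1 + b) * c * √(2 * (p.1:ℝ)) := by positivity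
      nlinarith [mul_le_mul_of_nonneg_left h2 h3]
    obtain ⟨h4, h5⟩ := hg p.1 hp _ key
    exact ⟨(mul_pos_iff_of_pos_left hy0).mp h4, h5⟩
  have heq : ∀ᶠ p in l, ∀ η, T < η →
      ((G*a/((G*a+1)*(a+1))) ^ ((p.1:ℝ) - (p.2:ℝ) + 1/2) * Real.exp ((p.1:ℝ) - (p.2:ℝ)) *
            Real.exp (-((G*a^2-1)/((G*a+1)*(a+1))) * (p.1:ℝ) *
              ((1 + a) * (1 + b) * (1 + c * η / √(2 * (p.1:ℝ))))) *
            Real.exp (-ε*η) * psi p.1 p.2 a ((1 + a) * (1 + b) * (1 + c * η / √(2 * (p.1:ℝ))))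
          - Real.exp (-(1/4)*κ*η^2 - ε*η)) ^ 2
        = (Real.exp (-ε*η) * (f p η * (1 - R p η) - Real.exp (-(1/4)*κ*η^2))) ^ 2 := by
    filter_upwards [hev] with p hp η hη
    have h1 := rescaled_psi_eq hb hba hab hp.1 (hp.2.2.2.2 η hη).1
    congr 1
    rw [mul_sub, hf, hR, ← h1, sub_eq_add_neg (-(1/4)*κ*η^2), Real.exp_add, ← neg_mul]
    ring
  rw [show (0 : ℝ) = ∫ η in Set.Ioi T, (0 : ℝ) by simp]
  refine tendsto_integral_filter_of_dominated_convergence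
    (fun η => (10 + 8 * c / ε) * Real.exp (2 * ε * |T|) * Real.exp (-ε * η)) ?_ ?_ ?_ ?_
  · refine Filter.Eventually.of_forall fun p => Measurable.aestronglyMeasurable ?_
    have := measurable_psi p.1 p.2 a
    fun_prop
  · filter_upwards [hev, heq] with p hp hpe
    filter_upwards [ae_restrict_mem measurableSet_Ioi] with η hη
    obtain ⟨hpM, hp1, hp21, hρ1, hpη⟩ := hp
    obtain ⟨hw, hRη⟩ := hpη η hη
    have hK : (0 : ℝ) ≤ (p.1:ℝ) - (p.2:ℝ) := sub_nonneg.mpr (by exact_mod_cast hp21)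
    have hsq : 1 ≤ √(2 * (p.1:ℝ)) := by
      rw [Real.one_le_sqrt]
      have : (1 : ℝ) ≤ p.1 := by exact_mod_cast hp1
      linarith
    have hf2 : f p η ^ 2 ≤ 1 + c * |η| := by
      refine (sq_rpow_mul_exp_le hK hw).trans ?_
      gcongr
      calc c * η / √(2 * (p.1:ℝ)) ≤ c * |η| / √(2 * (p.1:ℝ)) := by
            gcongr; exact le_abs_self η
        _ ≤ c * |η| := div_le_self (by positivity) hsq
    have hg1 : Real.exp (-(1/4)*κ*η^2) ≤ 1 := by
      rw [Real.exp_le_one_iff]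
      nlinarith [mul_nonneg hκ0 (sq_nonneg η)]
    have hg0 := Real.exp_pos (-(1/4)*κ*η^2)
    have hR2 : (1 - R p η) ^ 2 ≤ 4 := by
      have := abs_le.mp (hRη.trans hρ1)
      nlinarith
    have hdiff : (f p η * (1 - R p η) - Real.exp (-(1/4)*κ*η^2)) ^ 2 ≤ 10 + 8 * c * |η| := by
      have h1 : (f p η * (1 - R p η)) ^ 2 ≤ 4 * (1 + c * |η|) := by
        rw [mul_pow, mul_comm]
        gcongr
      nlinarith [sq_nonneg (f p η * (1 - R p η) + Real.exp (-(1/4)*κ*η^2))]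
    have hη2 : |η| ≤ η + 2 * |T| := by
      have h1 : T < η := hη
      rcases abs_cases η with h | h <;> rcases abs_cases T with h' | h' <;> linarith
    have hexp : 10 + 8 * c * |η| ≤
        (10 + 8 * c / ε) * (Real.exp (2 * ε * |T|) * Real.exp (ε * η)) := by
      have h1 : ε * |η| ≤ Real.exp (ε * |η|) := by linarith [Real.add_one_le_exp (ε * |η|)]
      have h2 : 1 ≤ Real.exp (ε * |η|) := Real.one_le_exp (by positivity)
      have h3 : Real.exp (ε * |η|) ≤ Real.exp (2 * ε * |T|) * Real.exp (ε * η) := by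
        rw [← Real.exp_add]
        apply Real.exp_le_exp.mpr
        nlinarith
      calc 10 + 8 * c * |η| = 10 * 1 + 8 * c / ε * (ε * |η|) := by field_simp
        _ ≤ 10 * Real.exp (ε * |η|) + 8 * c / ε * Real.exp (ε * |η|) := by gcongr
        _ = (10 + 8 * c / ε) * Real.exp (ε * |η|) := by ring
        _ ≤ _ := by gcongr
    rw [hpe η hη, Real.norm_eq_abs, abs_of_nonneg (sq_nonneg _), mul_pow]
    calc _ ≤ Real.exp (-ε * η) ^ 2 *
          ((10 + 8 * c / ε) * (Real.exp (2 * ε * |T|) * Real.exp (ε * η))) := by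
          gcongr
          exact hdiff.trans hexp
      _ = (10 + 8 * c / ε) * Real.exp (2 * ε * |T|) *
          (Real.exp (-ε * η) * (Real.exp (-ε * η) * Real.exp (ε * η))) := by ring
      _ = _ := by
          rw [← Real.exp_add (-ε * η) (ε * η)]
          simp
  · exact (exp_neg_integrableOn_Ioi T hε).const_mul _
  · filter_upwards [ae_restrict_mem measurableSet_Ioi] with η hη
    have hu : Filter.Tendsto (fun p : ℕ × ℕ => c * η / √(2 * (p.1:ℝ))) l (nhds 0) := by
      refine Filter.Tendsto.const_div_atTop ?_ _
      refine Real.tendsto_sqrt_atTop.comp ?_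
      refine ((hNreal.const_mul_atTop hG0).const_mul_atTop two_pos).congr' ?_
      filter_upwards [hlM] with p hp
      rw [hp]
    have hKu : Filter.Tendsto (fun p : ℕ × ℕ =>
        ((p.1:ℝ) - (p.2:ℝ)) * (c * η / √(2 * (p.1:ℝ))) ^ 2) l (nhds (κ * η ^ 2 / 2)) := by
      refine tendsto_const_nhds.congr' ?_
      filter_upwards [hev] with p hp
      have hp2 : (0 : ℝ) < p.2 := by
        have h1 : (1 : ℝ) ≤ p.1 := by exact_mod_cast hp.2.1
        rw [hp.1] at h1
        by_contra! h
        nlinarith [mul_nonneg hG0.le (neg_nonneg.mpr h)]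
      rw [div_pow, Real.sq_sqrt (by positivity), hp.1, hκ]
      field_simp
    have hflim := tendsto_rpow_mul_exp_gaussian hu hKu
    have hRlim : Filter.Tendsto (fun p => R p η) l (nhds 0) := by
      refine squeeze_zero_norm' ?_ (hρ.comp hl)
      filter_upwards [hev] with p hp
      exact (hp.2.2.2.2 η hη).2
    have hlim := (((hflim.mul (hRlim.const_sub 1)).sub_const
      (Real.exp (-(1/4)*κ*η^2))).const_mul (Real.exp (-ε*η))).pow 2
    have e : (Real.exp (-ε*η) * (Real.exp (-(κ * η ^ 2 / 2 / 2)) * (1 - 0) -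
        Real.exp (-(1/4)*κ*η^2))) ^ 2 = 0 := by
      rw [show -(κ * η ^ 2 / 2 / 2) = -(1/4)*κ*η^2 by ring]
      ring
    rw [e] at hlim
    refine hlim.congr' ?_
    filter_upwards [heq] with p hp
    exact (hp η hη).symm

theorem stmt15 (γ : ℝ) (hγ : 1 ≤ γ) (hγ2 : ∃ q : ℚ, (q:ℝ) = γ^2)
    (a : ℝ) (ha : γ⁻¹ < a) (ε : ℝ) (hε : 0 < ε) (T : ℝ) :
    ∀ δ : ℝ, 0 < δ → ∃ M0 : ℕ, ∀ M N : ℕ, 0 < N → (M:ℝ) = γ^2 * N → M0 ≤ M →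
      (∫ η in Set.Ioi T,
        ((γ^2*a/((γ^2*a+1)*(a+1))) ^ ((M:ℝ) - (N:ℝ) + 1/2) *
            Real.exp ((M:ℝ) - (N:ℝ)) *
            Real.exp (-((γ^2*a^2-1)/((γ^2*a+1)*(a+1))) * (M:ℝ) * yM γ a M η) *
            Real.exp (-ε*η) * psi M N a (yM γ a M η)
          - Real.exp (-(1/4)*((γ^2*a^2-1)*(γ^2-1)/(γ^2*a+1)^2)*η^2 - ε*η)) ^ 2) < δ := by
  have hγ0 : 0 < γ := by linarith
  have ha0 : 0 < a := (inv_pos.mpr hγ0).trans ha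
  have hγa : 1 < γ * a := by
    have := mul_lt_mul_of_pos_left ha hγ0
    rwa [mul_inv_cancel₀ hγ0.ne'] at this
  have hG : 1 ≤ γ ^ 2 := one_le_pow₀ hγ
  have hGa : 1 < γ ^ 2 * a ^ 2 := by
    rw [← mul_pow]
    exact one_lt_pow₀ hγa two_ne_zero
  have hb : 0 < 1 / (γ ^ 2 * a) := by positivity
  have hba : 1 / (γ ^ 2 * a) < a := by
    rw [div_lt_iff₀ (by positivity)]
    linarith
  have hab : γ ^ 2 * a * (1 / (γ ^ 2 * a)) = 1 := by field_simp
  have hr2 : √(1 - 1 / (γ ^ 2 * a ^ 2)) ^ 2 = 1 - 1 / (γ ^ 2 * a ^ 2) := by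
    apply Real.sq_sqrt
    rw [sub_nonneg, div_le_one (by positivity)]
    exact hGa.le
  have hκ : (γ^2*a^2-1)*(γ^2-1)/(γ^2*a+1)^2 =
      (1 - 1 / γ ^ 2) * (√(1 - 1 / (γ ^ 2 * a ^ 2)) / (1 + 1 / (γ ^ 2 * a))) ^ 2 := by
    rw [div_pow, hr2]
    field_simp
  set l : Filter (ℕ × ℕ) := Filter.comap Prod.fst Filter.atTop ⊓
    Filter.principal {p : ℕ × ℕ | 0 < p.2 ∧ (p.1 : ℝ) = γ ^ 2 * p.2} with hl
  have hlM : ∀ᶠ p in l, (p.1 : ℝ) = γ ^ 2 * p.2 := by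
    rw [hl, Filter.eventually_inf_principal]
    exact Filter.Eventually.of_forall fun p hp => hp.2
  have hlt : Filter.Tendsto Prod.snd l Filter.atTop := by
    have h1 : Filter.Tendsto (fun p : ℕ × ℕ => (p.1 : ℝ)) l Filter.atTop :=
      tendsto_natCast_atTop_atTop.comp (Filter.tendsto_comap.mono_left inf_le_left)
    rw [← tendsto_natCast_atTop_iff (R := ℝ)]
    refine (h1.atTop_div_const (by positivity : 0 < γ ^ 2)).congr' ?_
    filter_upwards [hlM] with p hp
    rw [hp]
    field_simp
  have key := tendsto_integral_rescaled_psi hG hb hba hab (by positivity) hκ hε T hlt hlM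
  intro δ hδ
  have hev := key.eventually_lt_const hδ
  rw [hl, Filter.eventually_inf_principal, Filter.eventually_comap, Filter.eventually_atTop] at hev
  obtain ⟨M0, hM0⟩ := hev
  refine ⟨M0, fun M N hN hM hM0M => ?_⟩
  refine lt_of_eq_of_lt ?_ (hM0 M hM0M (M, N) rfl ⟨hN, hM⟩)
  have hy : ∀ η, yM γ a M η = (1 + a) * (1 + 1 / (γ ^ 2 * a)) *
      (1 + √(1 - 1 / (γ ^ 2 * a ^ 2)) / (1 + 1 / (γ ^ 2 * a)) * η / √(2 * (M:ℝ))) := by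
    intro η
    have : 1 + 1 / (γ ^ 2 * a) ≠ 0 := by positivity
    rw [yM, mul_add ((1 + a) * (1 + 1 / (γ ^ 2 * a))), mul_one]
    congr 1
    · ring
    · generalize 1 + 1 / (γ ^ 2 * a) = t at *
      field_simp
      ring
  simp only [hy]
end
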